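/- Let Ω = [B₋, B₊] with B₋ < B₊, let a, b : ℝ → ℝ be continuously differentiable with b(x) > 0 and c(x) := b(x) − a(x)² > 0 on Ω, and set λ₁(x) := a(x) + √(b(x)) and λ₂(x) := a(x) − √(b(x)) (so that λ₁ > 0 > λ₂ on Ω). Let u : ℝ × [0,∞) → ℝ be twice continuously differentiable and solve the shifted wave equation ∂t(∂t u − a ∂x u) − ∂x(a(∂t u − a ∂x u) + b ∂x u) = 0 on Ω × [0,∞), subject to the boundary conditions (∂t u − λ₁ ∂x u)(B₋, t) = g₁(t) and (∂t u − λ₂ ∂x u)(B₊, t) = g₂(t). Define E_b(t) := ∫_Ω (∂t u − a ∂x u)² dx + ∫_Ω b (∂x u)² dx, C_{a,b} := max_{x∈Ω}(|a'(x)| + |a'(x) − (a(x)/b(x)) b'(x)|), and BT₁(t) := (λ₁(B₋)/2)·[(∂t u − λ₂ ∂x u)(B₋, t)]² − (λ₂(B₊)/2)·[(∂t u − λ₁ ∂x u)(B₊, t)]². Then BT₁(t) ≥ 0 and d/dt E_b(t) − C_{a,b} E_b(t) + BT₁(t) ≤ (λ₁(B₊)/2)·g₂(t)² − (λ₂(B₋)/2)·g₁(t)²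 for all t ≥ 0. -/

import Mathlib

open MeasureTheory

/-- Partial derivative in time of `u : ℝ → ℝ → ℝ` (first argument is space). -/
noncomputable def pdt (u : ℝ → ℝ → ℝ) (x t : ℝ) : ℝ := deriv (fun s => u x s) t

/-- Partial derivative in space of `u : ℝ → ℝ → ℝ` (first argument is space). -/
noncomputable def pdx (u : ℝ → ℝ → ℝ) (x t : ℝ) : ℝ := deriv (fun y => u y t) x

section PartialDerivatives

variable {u : ℝ → ℝ → ℝ}

theorem hasDerivAt_pdt (hu : Differentiable ℝ (fun p : ℝ × ℝ => u p.1 p.2)) (x t : ℝ) :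
    HasDerivAt (fun s => u x s) (pdt u x t) t := by
  have h : Differentiable ℝ (fun s => u x s) :=
    hu.comp ((differentiable_const x).prodMk differentiable_id)
  exact (h t).hasDerivAt

theorem hasDerivAt_pdx (hu : Differentiable ℝ (fun p : ℝ × ℝ => u p.1 p.2)) (x t : ℝ) :
    HasDerivAt (fun y => u y t) (pdx u x t) x := by
  have h : Differentiable ℝ (fun y => u y t) :=
    hu.comp (differentiable_id.prodMk (differentiable_const t))
  exact (h x).hasDerivAt

theorem pdt_eq_fderiv (hu : Differentiable ℝ (fun p : ℝ × ℝ => u p.1 p.2)) (x t : ℝ) :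
    pdt u x t = fderiv ℝ (fun p : ℝ × ℝ => u p.1 p.2) (x, t) (0, 1) :=
  (hasDerivAt_pdt hu x t).unique ((hu (x, t)).hasFDerivAt.comp_hasDerivAt t
    ((hasDerivAt_const t x).prodMk (hasDerivAt_id t)))

theorem pdx_eq_fderiv (hu : Differentiable ℝ (fun p : ℝ × ℝ => u p.1 p.2)) (x t : ℝ) :
    pdx u x t = fderiv ℝ (fun p : ℝ × ℝ => u p.1 p.2) (x, t) (1, 0) := by
  have h : HasDerivAt (fun y : ℝ => (y, t)) (1, 0) x :=
    (hasDerivAt_id x).prodMk (hasDerivAt_const x t)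
  have h' := (hu (x, t)).hasFDerivAt.comp_hasDerivAt x h
  exact (hasDerivAt_pdx hu x t).unique h'

theorem contDiff_pdt {n : ℕ} (hu : ContDiff ℝ (n + 1) (fun p : ℝ × ℝ => u p.1 p.2)) :
    ContDiff ℝ n (fun p : ℝ × ℝ => pdt u p.1 p.2) := by
  simp only [pdt_eq_fderiv (hu.differentiable (by simp))]
  exact (hu.fderiv_right le_rfl).clm_apply contDiff_const

theorem contDiff_pdx {n : ℕ} (hu : ContDiff ℝ (n + 1) (fun p : ℝ × ℝ => u p.1 p.2)) :
    ContDiff ℝ n (fun p : ℝ × ℝ => pdx u p.1 p.2) := by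
  simp only [pdx_eq_fderiv (hu.differentiable (by simp))]
  exact (hu.fderiv_right le_rfl).clm_apply contDiff_const

theorem pdt_pdx_comm (hu : ContDiff ℝ 2 (fun p : ℝ × ℝ => u p.1 p.2)) (x t : ℝ) :
    pdt (pdx u) x t = pdx (pdt u) x t := by
  have hd : Differentiable ℝ (fun p : ℝ × ℝ => u p.1 p.2) := hu.differentiable (by simp)
  have hu' : ContDiff ℝ ((1 : ℕ) + 1) (fun p : ℝ × ℝ => u p.1 p.2) := by
    convert hu using 1; norm_num
  have hd' : DifferentiableAt ℝ (fderiv ℝ (fun p : ℝ × ℝ => u p.1 p.2)) (x, t) :=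
    (hu'.fderiv_right le_rfl).differentiable (by simp) _
  rw [pdt_eq_fderiv ((contDiff_pdx hu').differentiable (by simp)),
    pdx_eq_fderiv ((contDiff_pdt hu').differentiable (by simp))]
  simp only [pdx_eq_fderiv hd, pdt_eq_fderiv hd, Prod.mk.eta]
  rw [fderiv_clm_apply hd' (differentiableAt_const _),
    fderiv_clm_apply hd' (differentiableAt_const _)]
  simpa using (hu.contDiffAt.isSymmSndFDerivAt (by simp)).eq (0, 1) (1, 0)

theorem hasDerivAt_intervalIntegral_pdt (hu : ContDiff ℝ 1 (fun p : ℝ × ℝ => u p.1 p.2))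
    (p q t : ℝ) :
    HasDerivAt (fun s => ∫ x in p..q, u x s) (∫ x in p..q, pdt u x t) t := by
  have hd : Differentiable ℝ (fun p : ℝ × ℝ => u p.1 p.2) := hu.differentiable (by simp)
  have hc : Continuous (fun p : ℝ × ℝ => pdt u p.1 p.2) :=
    (contDiff_pdt (n := 0) (by simpa using hu)).continuous
  obtain ⟨M, hM⟩ := ((isCompact_uIcc (a := p) (b := q)).prod
    (isCompact_closedBall t 1)).exists_bound_of_continuousOn hc.continuousOn
  have hcu : ∀ s, Continuous fun x => u x s := fun s =>
    hu.continuous.comp (continuous_id.prodMk continuous_const)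
  have hcd : Continuous fun x => pdt u x t :=
    hc.comp (continuous_id.prodMk continuous_const)
  refine (intervalIntegral.hasDerivAt_integral_of_dominated_loc_of_deriv_le
    (F := fun s x => u x s) (F' := fun s x => pdt u x s) (bound := fun _ => M)
    (Metric.closedBall_mem_nhds t one_pos) (.of_forall fun s => (hcu s).aestronglyMeasurable)
    ((hcu t).intervalIntegrable _ _) hcd.aestronglyMeasurable
    (.of_forall fun x hx s hs => hM (x, s) ⟨Set.uIoc_subset_uIcc hx, hs⟩)
    intervalIntegrable_const (.of_forall fun x _ s _ => hasDerivAt_pdt hd x s)).2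

end PartialDerivatives

/-- Energy balance for the first-order system `∂ₜv = ∂ₓ(av + bw)`, `∂ₜw = ∂ₓ(v + aw)`. -/
theorem hasDerivAt_energy {a b : ℝ → ℝ} {v w : ℝ → ℝ → ℝ} {p q t : ℝ}
    (ha : ContDiff ℝ 1 a) (hb : ContDiff ℝ 1 b)
    (hv : ContDiff ℝ 1 (fun p : ℝ × ℝ => v p.1 p.2))
    (hw : ContDiff ℝ 1 (fun p : ℝ × ℝ => w p.1 p.2))
    (hvt : ∀ x ∈ Set.uIcc p q, pdt v x t = deriv (fun y => a y * v y t + b y * w y t) x)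
    (hwt : ∀ x ∈ Set.uIcc p q, pdt w x t = deriv (fun y => v y t + a y * w y t) x) :
    HasDerivAt (fun s => (∫ x in p..q, v x s ^ 2) + ∫ x in p..q, b x * w x s ^ 2)
      ((a q * v q t ^ 2 + 2 * b q * v q t * w q t + a q * b q * w q t ^ 2)
        - (a p * v p t ^ 2 + 2 * b p * v p t * w p t + a p * b p * w p t ^ 2)
        + ∫ x in p..q, (deriv a x * v x t ^ 2
          + (deriv a x * b x - a x * deriv b x) * w x t ^ 2)) t := by
  have hvd := hv.differentiable (by simp)
  have hwd := hw.differentiable (by simp)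
  have hvc : Continuous fun x => v x t := hv.continuous.comp (continuous_id.prodMk continuous_const)
  have hwc : Continuous fun x => w x t := hw.continuous.comp (continuous_id.prodMk continuous_const)
  have hda : ∀ x, HasDerivAt a (deriv a x) x := fun x =>
    (ha.differentiable (by simp) x).hasDerivAt
  have hdb : ∀ x, HasDerivAt b (deriv b x) x := fun x =>
    (hb.differentiable (by simp) x).hasDerivAt
  have hca := ha.continuous
  have hcb := hb.continuous
  have hca' : Continuous (deriv a) := ha.continuous_deriv le_rfl
  have hcb' : Continuous (deriv b) := hb.continuous_deriv le_rfl
  have hsum : ContDiff ℝ 1 (fun p : ℝ × ℝ => v p.1 p.2 ^ 2 + b p.1 * w p.1 p.2 ^ 2) :=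
    (hv.pow 2).add ((hb.comp contDiff_fst).mul (hw.pow 2))
  have hflux : ContDiff ℝ 1 (fun x => a x * v x t ^ 2 + 2 * b x * v x t * w x t
      + a x * b x * w x t ^ 2) := by
    have hv' : ContDiff ℝ 1 fun x => v x t := hv.comp (contDiff_id.prodMk contDiff_const)
    have hw' : ContDiff ℝ 1 fun x => w x t := hw.comp (contDiff_id.prodMk contDiff_const)
    fun_prop
  have hsplit : ∀ s, (∫ x in p..q, v x s ^ 2) + (∫ x in p..q, b x * w x s ^ 2)
      = ∫ x in p..q, (v x s ^ 2 + b x * w x s ^ 2) := by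
    intro s
    have hv' : Continuous fun x => v x s :=
      hv.continuous.comp (continuous_id.prodMk continuous_const)
    have hw' : Continuous fun x => w x s :=
      hw.continuous.comp (continuous_id.prodMk continuous_const)
    exact (intervalIntegral.integral_add ((hv'.pow 2).intervalIntegrable _ _)
      ((hcb.mul (hw'.pow 2)).intervalIntegrable _ _)).symm
  simp only [hsplit]
  refine (hasDerivAt_intervalIntegral_pdt
    (u := fun x s => v x s ^ 2 + b x * w x s ^ 2) hsum p q t).congr_deriv ?_
  rw [← intervalIntegral.integral_deriv_eq_sub
      (f := fun x => a x * v x t ^ 2 + 2 * b x * v x t * w x t + a x * b x * w x t ^ 2)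
      (fun x _ => hflux.differentiable (by simp) x)
      ((hflux.continuous_deriv le_rfl).intervalIntegrable _ _),
    ← intervalIntegral.integral_add ((hflux.continuous_deriv le_rfl).intervalIntegrable _ _)
      (Continuous.intervalIntegrable (by fun_prop) _ _)]
  refine intervalIntegral.integral_congr fun x hx => ?_
  have hvx := hasDerivAt_pdx hvd x t
  have hwx := hasDerivAt_pdx hwd x t
  have hvt' := hasDerivAt_pdt hvd x t
  have hwt' := hasDerivAt_pdt hwd x t
  have e₁ := (hvt x hx).trans (((hda x).mul hvx).add ((hdb x).mul hwx)).deriv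
  have e₂ := (hwt x hx).trans (hvx.add ((hda x).mul hwx)).deriv
  have e₃ : pdt (fun x s => v x s ^ 2 + b x * w x s ^ 2) x t = _ :=
    ((hvt'.pow 2).add ((hwt'.pow 2).const_mul (b x))).deriv
  have e₄ := ((((hda x).mul (hvx.pow 2)).add ((((hdb x).const_mul 2).mul hvx).mul hwx)).add
    (((hda x).mul (hdb x)).mul (hwx.pow 2))).deriv
  refine e₃.trans ((?_ : _ = _).trans (congrArg (· + _) e₄.symm))
  simp only [e₁, e₂, Pi.mul_apply, Pi.pow_apply]
  push_cast
  ring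

/-- boundary stability in the subsonic regime `c = b − a² > 0`, with
characteristic boundary conditions `∂ₜu − λ₁∂ₓu = g₁` at `B₋` and
`∂ₜu − λ₂∂ₓu = g₂` at `B₊`:
`BT₁ ≥ 0` and `d/dt E_b − C_{a,b} E_b + BT₁ ≤ (λ₁(B₊)/2)g₂² − (λ₂(B₋)/2)g₁²`. -/
theorem ibvp_energy_estimate_subsonic
    (Bm Bp : ℝ) (hB : Bm < Bp)
    (a b : ℝ → ℝ) (ha : ContDiff ℝ 1 a) (hb : ContDiff ℝ 1 b)
    (hbpos : ∀ x ∈ Set.Icc Bm Bp, 0 < b x)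
    (hcpos : ∀ x ∈ Set.Icc Bm Bp, 0 < b x - (a x) ^ 2)
    (u : ℝ → ℝ → ℝ) (hu : ContDiff ℝ 2 (fun p : ℝ × ℝ => u p.1 p.2))
    (hpde : ∀ x ∈ Set.Icc Bm Bp, ∀ t : ℝ, 0 ≤ t →
      deriv (fun s => pdt u x s - a x * pdx u x s) t
        - deriv (fun y => a y * (pdt u y t - a y * pdx u y t) + b y * pdx u y t) x = 0)
    (g₁ g₂ : ℝ → ℝ)
    (hbc1 : ∀ t : ℝ, 0 ≤ t →
      pdt u Bm t - (a Bm + Real.sqrt (b Bm)) * pdx u Bm t = g₁ t)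
    (hbc2 : ∀ t : ℝ, 0 ≤ t →
      pdt u Bp t - (a Bp - Real.sqrt (b Bp)) * pdx u Bp t = g₂ t)
    (E : ℝ → ℝ)
    (hE : E = fun t => (∫ x in Bm..Bp, (pdt u x t - a x * pdx u x t) ^ 2)
        + ∫ x in Bm..Bp, b x * (pdx u x t) ^ 2)
    (C : ℝ)
    (hC : C = sSup ((fun x => |deriv a x| + |deriv a x - a x / b x * deriv b x|) ''
        Set.Icc Bm Bp))
    (BT : ℝ → ℝ)
    (hBT : BT = fun t =>
      ((a Bm + Real.sqrt (b Bm)) / 2)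
          * (pdt u Bm t - (a Bm - Real.sqrt (b Bm)) * pdx u Bm t) ^ 2
        - ((a Bp - Real.sqrt (b Bp)) / 2)
          * (pdt u Bp t - (a Bp + Real.sqrt (b Bp)) * pdx u Bp t) ^ 2) :
    ∀ t : ℝ, 0 ≤ t → 0 ≤ BT t ∧
      deriv E t - C * E t + BT t
        ≤ ((a Bp + Real.sqrt (b Bp)) / 2) * (g₂ t) ^ 2
          - ((a Bm - Real.sqrt (b Bm)) / 2) * (g₁ t) ^ 2 := by
  have hu' : ContDiff ℝ ((1 : ℕ) + 1) (fun p : ℝ × ℝ => u p.1 p.2) := by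
    convert hu using 1; norm_num
  have hT : ContDiff ℝ 1 (fun p : ℝ × ℝ => pdt u p.1 p.2) := mod_cast contDiff_pdt hu'
  have hX : ContDiff ℝ 1 (fun p : ℝ × ℝ => pdx u p.1 p.2) := mod_cast contDiff_pdx hu'
  have hV : ContDiff ℝ 1 (fun p : ℝ × ℝ => pdt u p.1 p.2 - a p.1 * pdx u p.1 p.2) :=
    hT.sub ((ha.comp contDiff_fst).mul hX)
  intro t ht
  have hIcc : Set.uIcc Bm Bp = Set.Icc Bm Bp := Set.uIcc_of_le hB.le
  have henergy := hasDerivAt_energy (v := fun x t => pdt u x t - a x * pdx u x t) (w := pdx u)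
    (p := Bm) (q := Bp) (t := t) ha hb hV hX
    (fun x hx => sub_eq_zero.mp (hpde x (hIcc ▸ hx) t ht))
    (fun x _ => by simpa [pdx] using pdt_pdx_comm hu x t)
  have hm : Bm ∈ Set.Icc Bm Bp := Set.left_mem_Icc.mpr hB.le
  have hp : Bp ∈ Set.Icc Bm Bp := Set.right_mem_Icc.mpr hB.le
  have hsm := Real.sq_sqrt (hbpos Bm hm).le
  have hsp := Real.sq_sqrt (hbpos Bp hp).le
  have ham := abs_lt.mp (Real.lt_sqrt_of_sq_lt ((sq_abs _).trans_lt (sub_pos.mp (hcpos Bm hm))))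
  have hap := abs_lt.mp (Real.lt_sqrt_of_sq_lt ((sq_abs _).trans_lt (sub_pos.mp (hcpos Bp hp))))
  refine ⟨?_, ?_⟩
  · have h₁ : 0 ≤ (a Bm + √(b Bm)) / 2 := by linarith
    have h₂ : 0 ≤ -((a Bp - √(b Bp)) / 2) := by linarith
    simp only [hBT]
    nlinarith [mul_nonneg h₁ (sq_nonneg (pdt u Bm t - (a Bm - √(b Bm)) * pdx u Bm t)),
      mul_nonneg h₂ (sq_nonneg (pdt u Bp t - (a Bp + √(b Bp)) * pdx u Bp t))]
  have hca' : Continuous (deriv a) := ha.continuous_deriv le_rfl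
  have hcb' : Continuous (deriv b) := hb.continuous_deriv le_rfl
  have hca := ha.continuous
  have hcb := hb.continuous
  have hvc : Continuous fun x => pdt u x t - a x * pdx u x t :=
    hV.continuous.comp (continuous_id.prodMk continuous_const)
  have hwc : Continuous fun x => pdx u x t :=
    hX.continuous.comp (continuous_id.prodMk continuous_const)
  have hbdd : BddAbove ((fun x => |deriv a x| + |deriv a x - a x / b x * deriv b x|) ''
      Set.Icc Bm Bp) := by
    refine (isCompact_Icc.image_of_continuousOn ?_).bddAbove
    have hdiv : ContinuousOn (fun x => a x / b x) (Set.Icc Bm Bp) :=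
      hca.continuousOn.div hcb.continuousOn fun x hx => (hbpos x hx).ne'
    exact hca'.continuousOn.abs.add
      (hca'.continuousOn.sub (hdiv.mul hcb'.continuousOn)).abs
  have hCle : ∀ x ∈ Set.Icc Bm Bp,
      |deriv a x| + |deriv a x - a x / b x * deriv b x| ≤ C := fun x hx =>
    hC ▸ le_csSup hbdd (Set.mem_image_of_mem _ hx)
  have hbulk : (∫ x in Bm..Bp, (deriv a x * (pdt u x t - a x * pdx u x t) ^ 2
      + (deriv a x * b x - a x * deriv b x) * pdx u x t ^ 2)) ≤ C * E t := by
    simp only [hE]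
    rw [← intervalIntegral.integral_add (Continuous.intervalIntegrable (by fun_prop) _ _)
        (Continuous.intervalIntegrable (by fun_prop) _ _),
      ← intervalIntegral.integral_const_mul]
    refine intervalIntegral.integral_mono_on hB.le
      (Continuous.intervalIntegrable (by fun_prop) _ _)
      (Continuous.intervalIntegrable (by fun_prop) _ _) fun x hx => ?_
    have hbx := hbpos x hx
    have h₁ : deriv a x ≤ C := by
      linarith [hCle x hx, le_abs_self (deriv a x),
        abs_nonneg (deriv a x - a x / b x * deriv b x)]
    have h₂ : deriv a x - a x / b x * deriv b x ≤ C := by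
      linarith [hCle x hx, abs_nonneg (deriv a x),
        le_abs_self (deriv a x - a x / b x * deriv b x)]
    have h₃ : deriv a x * b x - a x * deriv b x
        = (deriv a x - a x / b x * deriv b x) * b x := by
      field_simp
    rw [h₃, mul_add, mul_assoc (_ - _)]
    gcongr
  have hderiv := henergy.deriv
  rw [← hE] at hderiv
  rw [hderiv, ← hbc1 t ht, ← hbc2 t ht]
  simp only [hBT]
  have flux : ∀ β s α T X : ℝ, s ^ 2 = β →
      α * (T - α * X) ^ 2 + 2 * β * (T - α * X) * X + α * β * X ^ 2
        = (α + s) / 2 * (T - (α - s) * X) ^ 2 + (α - s) / 2 * (T - (α + s) * X) ^ 2 := by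
    rintro _ s α T X rfl
    ring
  rw [flux _ _ _ _ _ hsm, flux _ _ _ _ _ hsp]
  linarith
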